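/- Let 0 < α ≤ 1. Then the function t ↦ E_α(-t^α) is strictly decreasing on [0, ∞), and for 0 < α < 1 it tends to 0 as t → ∞. -/

import Mathlib

open Filter

/-- The one-parameter Mittag-Leffler function `E_α(x) = ∑ xⁿ / Γ(αn + 1)`. -/
noncomputable def mittagLeffler (α x : ℝ) : ℝ :=
  ∑' n : ℕ, x ^ n / Real.Gamma (α * n + 1)

open Real MeasureTheory Set Topology

theorem Real.rpow_sub_one_mul_exp_neg_le_Gamma {R s : ℝ} (hR : 0 < R) (hs : 1 ≤ s) :
    R ^ (s - 1) * exp (-R) ≤ Gamma s := by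
  have hint := GammaIntegral_convergent (zero_lt_one.trans_le hs)
  have hsub : Ioi R ⊆ Ioi 0 := Ioi_subset_Ioi hR.le
  rw [Gamma_eq_integral (zero_lt_one.trans_le hs), ← integral_exp_neg_Ioi R, ← integral_const_mul]
  calc ∫ x in Ioi R, R ^ (s - 1) * exp (-x)
      ≤ ∫ x in Ioi R, exp (-x) * x ^ (s - 1) := by
        refine setIntegral_mono_on ((integrableOn_exp_neg_Ioi R).const_mul _)
          (hint.mono_set hsub) measurableSet_Ioi fun x hx => ?_
        rw [mul_comm]
        exact mul_le_mul_of_nonneg_left (rpow_le_rpow hR.le (le_of_lt hx) (by linarith))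
          (exp_pos _).le
    _ ≤ ∫ x in Ioi 0, exp (-x) * x ^ (s - 1) := by
        refine setIntegral_mono_set hint ?_ hsub.eventuallyLE
        filter_upwards [ae_restrict_mem measurableSet_Ioi] with x hx
        exact mul_nonneg (exp_pos _).le (rpow_nonneg (le_of_lt hx) _)

/-- The two-parameter Mittag-Leffler function `E_{α,β}(x) = ∑ xⁿ / Γ(αn + β)`. -/
noncomputable def mittagLefflerTwo (α β x : ℝ) : ℝ :=
  ∑' n : ℕ, x ^ n / Gamma (α * n + β)

theorem summable_pow_div_Gamma {α : ℝ} (hα : 0 < α) (β x : ℝ) :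
    Summable fun n : ℕ => x ^ n / Gamma (α * n + β) := by
  set q : ℝ := |x| + 1 with hq
  have hq0 : 0 < q := by positivity
  set R : ℝ := q ^ α⁻¹ with hR
  have hR0 : 0 < R := rpow_pos_of_pos hq0 _
  have hRq : R ^ α = q := rpow_inv_rpow hq0.le hα.ne'
  have hgeo : Summable fun n : ℕ => (R ^ (β - 1) * exp (-R))⁻¹ * (|x| / q) ^ n :=
    (summable_geometric_of_lt_one (by positivity)
      ((div_lt_one hq0).2 (by linarith))).mul_left _
  refine Summable.of_norm_bounded_eventually_nat hgeo ?_
  have htend : Tendsto (fun n : ℕ => α * (n : ℝ) + β) atTop atTop :=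
    tendsto_atTop_add_const_right _ _ (tendsto_natCast_atTop_atTop.const_mul_atTop hα)
  filter_upwards [htend.eventually_ge_atTop 1] with n hn
  have hΓ := rpow_sub_one_mul_exp_neg_le_Gamma hR0 hn
  have hsplit : R ^ (α * n + β - 1) = q ^ n * R ^ (β - 1) := by
    rw [add_sub_assoc, rpow_add hR0, rpow_mul hR0.le, hRq, rpow_natCast]
  rw [hsplit] at hΓ
  rw [norm_div, norm_pow, norm_eq_abs, norm_eq_abs,
    abs_of_pos (Gamma_pos_of_pos (zero_lt_one.trans_le hn))]
  calc |x| ^ n / Gamma (α * n + β) ≤ |x| ^ n / (q ^ n * R ^ (β - 1) * exp (-R)) := by gcongr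
    _ = _ := by rw [div_pow]; field_simp

theorem continuous_mittagLefflerTwo {α β : ℝ} (hα : 0 < α) (hβ : 0 < β) :
    Continuous (mittagLefflerTwo α β) := by
  refine continuous_iff_continuousAt.2 fun x => ?_
  have hs : ContinuousOn (mittagLefflerTwo α β) (Icc (-(|x| + 1)) (|x| + 1)) := by
    refine continuousOn_tsum (fun n => by fun_prop) (summable_pow_div_Gamma hα β (|x| + 1))
      fun n y hy => ?_
    have hΓ : 0 < Gamma (α * n + β) := Gamma_pos_of_pos (by positivity)
    rw [norm_div, norm_pow, norm_eq_abs, norm_eq_abs, abs_of_pos hΓ]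
    have := abs_le.2 hy
    gcongr
  refine hs.continuousAt (Icc_mem_nhds ?_ ?_)
  · linarith [neg_abs_le x]
  · linarith [le_abs_self x]

theorem mittagLefflerTwo_zero (α β : ℝ) : mittagLefflerTwo α β 0 = 1 / Gamma β := by
  rw [mittagLefflerTwo, tsum_eq_single 0 fun n hn => by simp [hn]]
  simp

theorem mittagLefflerTwo_eq_add {α : ℝ} (hα : 0 < α) (β x : ℝ) :
    mittagLefflerTwo α β x = 1 / Gamma β + x * mittagLefflerTwo α (β + α) x := by
  rw [mittagLefflerTwo, (summable_pow_div_Gamma hα β x).tsum_eq_zero_add, mittagLefflerTwo,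
    ← tsum_mul_left]
  congr 1
  · simp
  · refine tsum_congr fun n => ?_
    rw [pow_succ', mul_div_assoc]
    congr 3
    push_cast
    ring

theorem integral_rpow_mul_sub_rpow {a b t : ℝ} (ha : 0 < a) (hb : 0 < b) (ht : 0 < t) :
    ∫ s in (0 : ℝ)..t, (t - s) ^ (b - 1) * s ^ (a - 1) =
      Gamma b * (t ^ (a + b - 1) * (Gamma a / Gamma (a + b))) := by
  have h := Complex.betaIntegral_scaled a b ht
  rw [Complex.betaIntegral_eq_Gamma_mul_div _ _ (by simpa) (by simpa)] at h
  have hcast : ∫ s in (0 : ℝ)..t, ((((t - s) ^ (b - 1) * s ^ (a - 1) : ℝ)) : ℂ) =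
      ∫ s in (0 : ℝ)..t, (s : ℂ) ^ ((a : ℂ) - 1) * ((t : ℂ) - s) ^ ((b : ℂ) - 1) := by
    refine intervalIntegral.integral_congr fun s hs => ?_
    rw [uIcc_of_le ht.le] at hs
    rw [mul_comm, Complex.ofReal_mul, Complex.ofReal_cpow hs.1,
      Complex.ofReal_cpow (sub_nonneg.2 hs.2)]
    push_cast
    rfl
  rw [← hcast, intervalIntegral.integral_ofReal] at h
  have h2 : ((t : ℂ) ^ ((a : ℂ) + b - 1) * (Complex.Gamma a * Complex.Gamma b /
      Complex.Gamma (a + b))) =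
      ((Gamma b * (t ^ (a + b - 1) * (Gamma a / Gamma (a + b))) : ℝ) : ℂ) := by
    rw [← Complex.ofReal_add a b, Complex.Gamma_ofReal, Complex.Gamma_ofReal,
      Complex.Gamma_ofReal]
    push_cast [Complex.ofReal_cpow ht.le]
    ring
  exact_mod_cast h.trans h2

theorem intervalIntegrable_rpow_mul_sub_rpow {a b t : ℝ} (ha : 0 < a) (hb : 0 < b) (ht : 0 < t) :
    IntervalIntegrable (fun s => (t - s) ^ (b - 1) * s ^ (a - 1)) volume 0 t := by
  refine intervalIntegral.intervalIntegrable_of_integral_ne_zero ?_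
  rw [integral_rpow_mul_sub_rpow ha hb ht]
  have := Gamma_pos_of_pos ha
  have := Gamma_pos_of_pos hb
  have := Gamma_pos_of_pos (add_pos ha hb)
  positivity

/-- The function `t ↦ t ^ (β - 1) * E_{α,β}(-t ^ α)`; for `β = 1` it is `t ↦ E_α(-t ^ α)`. -/
noncomputable def fractionalRelaxation (α β t : ℝ) : ℝ :=
  t ^ (β - 1) * mittagLefflerTwo α β (-(t ^ α))

theorem continuous_mittagLefflerTwo_neg_rpow {α β : ℝ} (hα : 0 < α) (hβ : 0 < β) :
    Continuous fun t : ℝ => mittagLefflerTwo α β (-(t ^ α)) :=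
  (continuous_mittagLefflerTwo hα hβ).comp (continuous_rpow_const hα.le).neg

theorem intervalIntegrable_sub_rpow_mul_fractionalRelaxation {α β γ t : ℝ} (hα : 0 < α)
    (hβ : 0 < β) (hγ : 0 < γ) (ht : 0 < t) :
    IntervalIntegrable (fun s => (t - s) ^ (γ - 1) * fractionalRelaxation α β s) volume 0 t := by
  simp only [fractionalRelaxation, ← mul_assoc]
  exact (intervalIntegrable_rpow_mul_sub_rpow hβ hγ ht).mul_continuousOn
    (continuous_mittagLefflerTwo_neg_rpow hα hβ).continuousOn

theorem rpow_mul_neg_rpow_pow {s : ℝ} (hs : 0 < s) (α β : ℝ) (n : ℕ) :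
    s ^ (β - 1) * (-(s ^ α)) ^ n = (-1) ^ n * s ^ (α * n + β - 1) := by
  rw [neg_pow, ← rpow_natCast (s ^ α), ← rpow_mul hs.le, mul_left_comm, ← rpow_add hs]
  congr 2
  ring

theorem integral_sub_rpow_mul_fractionalRelaxation {α β γ t : ℝ} (hα : 0 < α)
    (hβ : 0 < β) (hγ : 0 < γ) (ht : 0 < t) :
    ∫ s in (0 : ℝ)..t, (t - s) ^ (γ - 1) * fractionalRelaxation α β s =
      Gamma γ * fractionalRelaxation α (β + γ) t := by
  have ha : ∀ n : ℕ, 0 < α * n + β := fun n => by positivity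
  have hΓ : ∀ n : ℕ, 0 < Gamma (α * n + β) := fun n => Gamma_pos_of_pos (ha n)
  set F : ℕ → ℝ → ℝ := fun n s =>
    (-1) ^ n / Gamma (α * n + β) * ((t - s) ^ (γ - 1) * s ^ (α * n + β - 1)) with hF
  have hF_int : ∀ n, Integrable (F n) (volume.restrict (Ioc 0 t)) := fun n =>
    ((intervalIntegrable_iff_integrableOn_Ioc_of_le ht.le).1
      (intervalIntegrable_rpow_mul_sub_rpow (ha n) hγ ht)).const_mul _
  have hbeta : ∀ n : ℕ, ∫ s in Ioc 0 t, (t - s) ^ (γ - 1) * s ^ (α * n + β - 1) =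
      Gamma γ * (t ^ (α * n + β + γ - 1) * (Gamma (α * n + β) / Gamma (α * n + β + γ))) :=
    fun n => by
      rw [← intervalIntegral.integral_of_le ht.le, integral_rpow_mul_sub_rpow (ha n) hγ ht]
  have hF_norm : ∀ n : ℕ, ∫ s in Ioc 0 t, ‖F n s‖ =
      Gamma γ * t ^ (β + γ - 1) * ((t ^ α) ^ n / Gamma (α * n + (β + γ))) := fun n => by
    have : ∀ s ∈ Ioc 0 t, ‖F n s‖ =
        1 / Gamma (α * n + β) * ((t - s) ^ (γ - 1) * s ^ (α * n + β - 1)) := fun s hs => by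
      have h1 : 0 ≤ (t - s) ^ (γ - 1) := rpow_nonneg (sub_nonneg.2 hs.2) _
      have h2 : 0 ≤ s ^ (α * n + β - 1) := rpow_nonneg hs.1.le _
      simp only [hF, norm_mul, norm_div, norm_pow, norm_neg, norm_one, one_pow, norm_eq_abs,
        abs_of_pos (hΓ n), abs_of_nonneg h1, abs_of_nonneg h2]
    rw [setIntegral_congr_fun measurableSet_Ioc this, integral_const_mul, hbeta,
      ← rpow_natCast (t ^ α), ← rpow_mul ht.le, add_assoc, add_sub_assoc, rpow_add ht]
    have := (hΓ n).ne'
    field_simp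
  have hsum := hasSum_integral_of_summable_integral_norm hF_int (by
    simp only [hF_norm]
    exact (summable_pow_div_Gamma hα _ _).mul_left _)
  have hlim : ∫ s in Ioc 0 t, ∑' n, F n s =
      ∫ s in (0 : ℝ)..t, (t - s) ^ (γ - 1) * fractionalRelaxation α β s := by
    rw [intervalIntegral.integral_of_le ht.le]
    refine setIntegral_congr_fun measurableSet_Ioc fun s hs => ?_
    simp only [hF, fractionalRelaxation, mittagLefflerTwo, ← tsum_mul_left]
    refine tsum_congr fun n => ?_
    rw [← mul_div_assoc (s ^ (β - 1)), rpow_mul_neg_rpow_pow hs.1]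
    ring
  rw [← hlim, ← hsum.tsum_eq, fractionalRelaxation, mittagLefflerTwo, ← tsum_mul_left,
    ← tsum_mul_left]
  refine tsum_congr fun n => ?_
  simp only [hF]
  rw [integral_const_mul, hbeta, ← mul_div_assoc (t ^ (β + γ - 1)), rpow_mul_neg_rpow_pow ht, add_assoc]
  have := (hΓ n).ne'
  field_simp

theorem fractionalRelaxation_eq_sub {α t : ℝ} (hα : 0 < α) (ht : 0 < t) (β : ℝ) :
    fractionalRelaxation α β t =
      t ^ (β - 1) / Gamma β - fractionalRelaxation α (β + α) t := by
  rw [fractionalRelaxation, fractionalRelaxation, mittagLefflerTwo_eq_add hα, add_sub_right_comm,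
    rpow_add ht]
  ring

theorem fractionalRelaxation_one (α t : ℝ) :
    fractionalRelaxation α 1 t = mittagLeffler α (-(t ^ α)) := by
  simp [fractionalRelaxation, mittagLefflerTwo, mittagLeffler]

theorem integral_sub_rpow {α a t : ℝ} (hα : 0 < α) :
    ∫ s in a..t, (t - s) ^ (α - 1) = (t - a) ^ α / α := by
  rw [intervalIntegral.integral_comp_sub_left (fun s => s ^ (α - 1)) t,
    integral_rpow (Or.inl (by linarith))]
  simp [zero_rpow hα.ne']

theorem intervalIntegrable_sub_rpow {α t : ℝ} (hα : 0 < α) (ht : 0 < t) :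
    IntervalIntegrable (fun s => (t - s) ^ (α - 1)) volume 0 t := by
  simpa using intervalIntegrable_rpow_mul_sub_rpow one_pos hα ht

theorem integral_sub_rpow_mul_fractionalRelaxation_eq {α β t : ℝ} (hα : 0 < α) (hβ : 0 < β)
    (ht : 0 < t) :
    ∫ s in (0 : ℝ)..t, (t - s) ^ (α - 1) * fractionalRelaxation α β s =
      Gamma α * (t ^ (β - 1) / Gamma β - fractionalRelaxation α β t) := by
  rw [integral_sub_rpow_mul_fractionalRelaxation hα hβ hα ht, fractionalRelaxation_eq_sub hα ht β]
  ring

theorem continuousOn_fractionalRelaxation {α β : ℝ} (hα : 0 < α) (hβ : 0 < β) :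
    ContinuousOn (fractionalRelaxation α β) (Ioi 0) :=
  (continuousOn_id.rpow_const fun _ hx => Or.inl (ne_of_gt hx)).mul
    (continuous_mittagLefflerTwo_neg_rpow hα hβ).continuousOn

/-- The kernel `k(t) = t ^ (α - 1)` is log-convex: `k (t' - s) / k (t - s) ≤ k t' / k t`. -/
theorem sub_rpow_le_div_rpow_mul {α s t t' : ℝ} (hα1 : α ≤ 1) (hs : 0 < s) (hst : s < t)
    (htt' : t ≤ t') :
    (t' - s) ^ (α - 1) ≤ (t' / t) ^ (α - 1) * (t - s) ^ (α - 1) := by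
  have ht : 0 < t := hs.trans hst
  have ht' : 0 < t' := ht.trans_le htt'
  rw [← mul_rpow (by positivity) (sub_nonneg.2 hst.le)]
  refine rpow_le_rpow_of_nonpos (mul_pos (by positivity) (sub_pos.2 hst)) ?_ (by linarith)
  rw [div_mul_eq_mul_div, div_le_iff₀ ht]
  nlinarith

theorem fractionalRelaxation_pos {α t : ℝ} (hα0 : 0 < α) (hα1 : α ≤ 1) (ht : 0 < t) :
    0 < fractionalRelaxation α α t := by
  have hΓ : 0 < Gamma α := Gamma_pos_of_pos hα0
  by_contra hneg
  set f := fractionalRelaxation α α with hf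
  set H : ℝ → ℝ := fun s => mittagLefflerTwo α α (-(s ^ α)) with hH
  have hfH : ∀ s, f s = s ^ (α - 1) * H s := fun s => rfl
  have hHc : Continuous H := continuous_mittagLefflerTwo_neg_rpow hα0 hα0
  have hH0 : 0 < H 0 := by simp [hH, zero_rpow hα0.ne', mittagLefflerTwo_zero, hΓ]
  have hHt : H t ≤ 0 := by
    by_contra h
    exact hneg (mul_pos (rpow_pos_of_pos ht _) (not_le.1 h))
  obtain ⟨T, ⟨hTmem, hHT⟩, hTmin⟩ :=
    (isCompact_Icc.inter_right (isClosed_Iic.preimage hHc)).exists_isLeast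
      (⟨t, ⟨ht.le, le_rfl⟩, hHt⟩ : (Icc 0 t ∩ H ⁻¹' Iic 0).Nonempty)
  have hHT : H T ≤ 0 := hHT
  have hT0 : 0 < T := by
    refine lt_of_le_of_ne hTmem.1 fun h => ?_
    rw [← h] at hHT
    exact hH0.not_ge hHT
  have hfT : f T ≤ 0 := mul_nonpos_of_nonneg_of_nonpos (rpow_nonneg hT0.le _) hHT
  have hfpos : ∀ s, 0 < s → s < T → 0 < f s := fun s hs hsT => by
    refine mul_pos (rpow_pos_of_pos hs _) (not_le.1 fun h => ?_)
    exact (hTmin ⟨⟨hs.le, hsT.le.trans hTmem.2⟩, h⟩).not_gt hsT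
  obtain ⟨a, ⟨haT, hTa⟩, haα⟩ : ∃ a ∈ Ioo (T / 2) T, (T - a) ^ α < α * Gamma α / 2 := by
    have h1 : Tendsto (fun a => (T - a) ^ α) (𝓝[<] T) (𝓝 0) := by
      have : ContinuousAt (fun a => (T - a) ^ α) T :=
        ((continuous_rpow_const hα0.le).comp (continuous_const.sub continuous_id)).continuousAt
      simpa [ContinuousAt, zero_rpow hα0.ne'] using this.tendsto.mono_left nhdsWithin_le_nhds
    have h2 : ∀ᶠ a in 𝓝[<] T, a ∈ Ioo (T / 2) T := Ioo_mem_nhdsLT (by linarith)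
    exact (h2.and (h1.eventually_lt_const (by positivity))).exists
  have ha0 : 0 < a := by linarith
  obtain ⟨m, ⟨ham, hmT'⟩, hmax⟩ := isCompact_Icc.exists_isMaxOn (nonempty_Icc.2 hTa.le)
    ((continuousOn_fractionalRelaxation hα0 hα0).mono fun x hx => ha0.trans_le hx.1)
  have hfm : 0 < f m := (hfpos a ha0 hTa).trans_le (hmax ⟨le_rfl, hTa.le⟩)
  have hmT : m < T := lt_of_le_of_ne hmT' fun h => by
    rw [h] at hfm
    exact hfT.not_gt hfm
  have hm0 : 0 < m := ha0.trans_le ham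
  have hint := intervalIntegrable_sub_rpow_mul_fractionalRelaxation hα0 hα0 hα0 hT0
  have hmem : m ∈ uIcc 0 T := by rw [uIcc_of_le hT0.le]; exact ⟨hm0.le, hmT.le⟩
  have hint1 : IntervalIntegrable (fun s => (T - s) ^ (α - 1) * f s) volume 0 m :=
    hint.mono_set (uIcc_subset_uIcc_left hmem)
  have hint2 : IntervalIntegrable (fun s => (T - s) ^ (α - 1) * f s) volume m T :=
    hint.mono_set (uIcc_subset_uIcc_right hmem)
  have hsplit := intervalIntegral.integral_add_adjacent_intervals hint1 hint2
  rw [integral_sub_rpow_mul_fractionalRelaxation_eq hα0 hα0 hT0, ← hf] at hsplit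
  have hfirst : ∫ s in (0 : ℝ)..m, (T - s) ^ (α - 1) * f s ≤
      (T / m) ^ (α - 1) * (Gamma α * (m ^ (α - 1) / Gamma α - f m)) := by
    rw [hf, ← integral_sub_rpow_mul_fractionalRelaxation_eq hα0 hα0 hm0,
      ← intervalIntegral.integral_const_mul]
    refine intervalIntegral.integral_mono_on_of_le_Ioo hm0.le hint1
      ((intervalIntegrable_sub_rpow_mul_fractionalRelaxation hα0 hα0 hα0 hm0).const_mul _)
      fun s hs => ?_
    rw [← mul_assoc]
    exact mul_le_mul_of_nonneg_right (sub_rpow_le_div_rpow_mul hα1 hs.1 hs.2 hmT.le)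
      (hfpos s hs.1 (hs.2.trans hmT)).le
  have hsecond : ∫ s in m..T, (T - s) ^ (α - 1) * f s ≤ (T - m) ^ α / α * f m := by
    rw [← integral_sub_rpow hα0, ← intervalIntegral.integral_mul_const]
    refine intervalIntegral.integral_mono_on_of_le_Ioo hmT.le hint2
      (((intervalIntegrable_sub_rpow hα0 hT0).mono_set
        (uIcc_subset_uIcc_right hmem)).mul_const _) fun s hs => ?_
    exact mul_le_mul_of_nonneg_left (hmax ⟨ham.trans hs.1.le, hs.2.le⟩)
      (rpow_nonneg (sub_nonneg.2 hs.2.le) _)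
  have hc : 1 / 2 ≤ (T / m) ^ (α - 1) := by
    have h1 : (1 : ℝ) ≤ T / m := (one_le_div hm0).2 hmT.le
    calc (1 : ℝ) / 2 ≤ m / T := by rw [div_le_div_iff₀ two_pos hT0]; linarith
      _ = (T / m) ^ (-1 : ℝ) := by rw [rpow_neg_one, inv_div]
      _ ≤ (T / m) ^ (α - 1) := rpow_le_rpow_of_exponent_le h1 (by linarith)
  have hcm : (T / m) ^ (α - 1) * m ^ (α - 1) = T ^ (α - 1) := by
    rw [← mul_rpow (by positivity) hm0.le, div_mul_cancel₀ _ hm0.ne']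
  have hkey : (T / m) ^ (α - 1) * Gamma α * f m ≤ (T - m) ^ α / α * f m := by
    have e1 : Gamma α * (m ^ (α - 1) / Gamma α - f m) = m ^ (α - 1) - Gamma α * f m := by
      field_simp
    have e2 : Gamma α * (T ^ (α - 1) / Gamma α - f T) = T ^ (α - 1) - Gamma α * f T := by
      field_simp
    rw [e1, mul_sub, hcm] at hfirst
    rw [e2] at hsplit
    have := mul_nonpos_of_nonneg_of_nonpos hΓ.le hfT
    linarith
  have hkey' := le_of_mul_le_mul_right hkey hfm
  rw [le_div_iff₀ hα0] at hkey'
  have hle : (T - m) ^ α ≤ (T - a) ^ α :=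
    rpow_le_rpow (sub_nonneg.2 hmT.le) (by linarith) hα0.le
  nlinarith [mul_le_mul_of_nonneg_right hc (mul_pos hΓ hα0).le]

theorem intervalIntegrable_fractionalRelaxation {α t : ℝ} (hα : 0 < α) (ht : 0 ≤ t) :
    IntervalIntegrable (fractionalRelaxation α α) volume 0 t := by
  rcases ht.eq_or_lt with rfl | ht
  · exact .refl
  · simpa using intervalIntegrable_sub_rpow_mul_fractionalRelaxation hα hα one_pos ht

theorem mittagLeffler_neg_rpow_eq {α t : ℝ} (hα : 0 < α) (ht : 0 ≤ t) :
    mittagLeffler α (-(t ^ α)) = 1 - ∫ s in (0 : ℝ)..t, fractionalRelaxation α α s := by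
  rw [← fractionalRelaxation_one]
  rcases ht.eq_or_lt with rfl | ht
  · simp [fractionalRelaxation, zero_rpow hα.ne', mittagLefflerTwo_zero]
  · have h := integral_sub_rpow_mul_fractionalRelaxation hα hα one_pos ht
    simp only [sub_self, rpow_zero, one_mul, Gamma_one] at h
    rw [h, fractionalRelaxation_eq_sub hα ht, add_comm]
    simp

theorem strictAntiOn_mittagLeffler_neg_rpow {α : ℝ} (hα0 : 0 < α) (hα1 : α ≤ 1) :
    StrictAntiOn (fun t : ℝ => mittagLeffler α (-(t ^ α))) (Ici 0) := by
  intro x hx y hy hxy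
  have hx : 0 ≤ x := hx
  have hy : 0 ≤ y := hy
  have hintx := intervalIntegrable_fractionalRelaxation hα0 hx
  have hintxy := hintx.symm.trans (intervalIntegrable_fractionalRelaxation hα0 hy)
  have hpos := intervalIntegral.intervalIntegral_pos_of_pos_on hintxy
    (fun s hs => fractionalRelaxation_pos hα0 hα1 (hx.trans_lt hs.1)) hxy
  have hadd := intervalIntegral.integral_add_adjacent_intervals hintx hintxy
  simp only [mittagLeffler_neg_rpow_eq hα0 hx, mittagLeffler_neg_rpow_eq hα0 hy]
  linarith

theorem mittagLeffler_neg_rpow_nonneg {α t : ℝ} (hα0 : 0 < α) (hα1 : α ≤ 1) (ht : 0 < t) :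
    0 ≤ mittagLeffler α (-(t ^ α)) := by
  have hΓ : 0 < Gamma α := Gamma_pos_of_pos hα0
  have hk : 0 < t ^ (α - 1) := rpow_pos_of_pos ht _
  have heq := integral_sub_rpow_mul_fractionalRelaxation_eq hα0 hα0 ht
  rw [mul_sub, mul_div_cancel₀ _ hΓ.ne'] at heq
  have hle : ∫ s in (0 : ℝ)..t, t ^ (α - 1) * fractionalRelaxation α α s ≤
      ∫ s in (0 : ℝ)..t, (t - s) ^ (α - 1) * fractionalRelaxation α α s := by
    refine intervalIntegral.integral_mono_on_of_le_Ioo ht.le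
      ((intervalIntegrable_fractionalRelaxation hα0 ht.le).const_mul _)
      (intervalIntegrable_sub_rpow_mul_fractionalRelaxation hα0 hα0 hα0 ht) fun s hs => ?_
    exact mul_le_mul_of_nonneg_right
      (rpow_le_rpow_of_nonpos (sub_pos.2 hs.2) (by linarith [hs.1]) (by linarith))
      (fractionalRelaxation_pos hα0 hα1 hs.1).le
  rw [intervalIntegral.integral_const_mul] at hle
  rw [mittagLeffler_neg_rpow_eq hα0 ht.le, sub_nonneg]
  have := mul_pos hΓ (fractionalRelaxation_pos hα0 hα1 ht)
  exact le_of_mul_le_mul_left (by linarith) hk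

theorem mittagLeffler_neg_rpow_le {α t : ℝ} (hα0 : 0 < α) (hα1 : α ≤ 1) (ht : 0 < t) :
    mittagLeffler α (-(t ^ α)) ≤ α * Gamma α / t ^ α := by
  have hΓ : 0 < Gamma α := Gamma_pos_of_pos hα0
  have hu := mittagLeffler_neg_rpow_nonneg hα0 hα1 ht
  have heq := integral_sub_rpow_mul_fractionalRelaxation_eq hα0 one_pos ht
  have hle : ∫ s in (0 : ℝ)..t, (t - s) ^ (α - 1) * mittagLeffler α (-(t ^ α)) ≤
      ∫ s in (0 : ℝ)..t, (t - s) ^ (α - 1) * fractionalRelaxation α 1 s := by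
    refine intervalIntegral.integral_mono_on_of_le_Ioo ht.le
      ((intervalIntegrable_sub_rpow hα0 ht).mul_const _)
      (intervalIntegrable_sub_rpow_mul_fractionalRelaxation hα0 one_pos hα0 ht) fun s hs => ?_
    rw [fractionalRelaxation_one]
    exact mul_le_mul_of_nonneg_left
      (strictAntiOn_mittagLeffler_neg_rpow hα0 hα1 hs.1.le ht.le hs.2).le
      (rpow_nonneg (sub_nonneg.2 hs.2.le) _)
  rw [heq, intervalIntegral.integral_mul_const, integral_sub_rpow hα0,
    fractionalRelaxation_one] at hle
  simp only [sub_self, rpow_zero, Gamma_one, sub_zero, div_one] at hle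
  rw [le_div_iff₀ (rpow_pos_of_pos ht _)]
  rw [div_mul_eq_mul_div, div_le_iff₀ hα0] at hle
  nlinarith [mul_nonneg (mul_pos hΓ hα0).le hu]

/-- For `0 < α ≤ 1`, `t ↦ E_α(-t^α)` is strictly decreasing on `[0, ∞)`, and for
`0 < α < 1` it tends to `0` as `t → ∞`. -/
theorem mittagLeffler_strictAnti_tendsto_zero
    (α : ℝ) (hα0 : 0 < α) (hα1 : α ≤ 1) :
    StrictAntiOn (fun t : ℝ => mittagLeffler α (-(t ^ α))) (Set.Ici (0 : ℝ)) ∧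
    (α < 1 →
      Tendsto (fun t : ℝ => mittagLeffler α (-(t ^ α))) atTop (nhds 0)) := by
  refine ⟨strictAntiOn_mittagLeffler_neg_rpow hα0 hα1, fun _ => ?_⟩
  refine tendsto_of_tendsto_of_tendsto_of_le_of_le' tendsto_const_nhds
    ((tendsto_rpow_atTop hα0).const_div_atTop (α * Gamma α)) ?_ ?_
  · filter_upwards [eventually_gt_atTop 0] with t ht
    exact mittagLeffler_neg_rpow_nonneg hα0 hα1 ht
  · filter_upwards [eventually_gt_atTop 0] with t ht
    exact mittagLeffler_neg_rpow_le hα0 hα1 ht
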